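/- Let r > 0, let q = e^{−π√r}, and let k ∈ (0,1) satisfy K(√(1−k²)) = √r · K(k). Then ∑_{n∈ℤ} (−1)^n q^{2n² + n} = q^{1/24} · η(q⁴) · (4(1−k²)/k)^{1/12}. -/

import Mathlib

open Real

/-- Complete elliptic integral of the first kind. -/
noncomputable def ellK (x : ℝ) : ℝ :=
  ∫ θ in (0:ℝ)..(π/2), (1 - x ^ 2 * Real.sin θ ^ 2) ^ (-(1:ℝ)/2)

/-- The eta product `η(q) = ∏_{n≥1} (1 - q^n)` (real powers). -/
noncomputable def etaP (q : ℝ) : ℝ := ∏' n : ℕ, (1 - q ^ ((n : ℝ) + 1))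

/-- `A(a,p;q) = q^{p/12 - a/2 + a²/(2p)} ∏_{n≥1} (1 - q^{np+a})(1 - q^{np+p-a})`. -/
noncomputable def Afun (a p q : ℝ) : ℝ :=
  q ^ (p / 12 - a / 2 + a ^ 2 / (2 * p)) *
    ∏' n : ℕ, ((1 - q ^ (((n : ℝ) + 1) * p + a)) * (1 - q ^ (((n : ℝ) + 1) * p + p - a)))

section ThetaFunctions

open Filter Topology

/-- Gauss's elliptic integral `∫₀^{π/2} dθ / √(a² cos² θ + b² sin² θ)`. -/
noncomputable def gaussIntegral (a b : ℝ) : ℝ :=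
  ∫ θ in (0:ℝ)..(π/2), (√(a ^ 2 * cos θ ^ 2 + b ^ 2 * sin θ ^ 2))⁻¹

lemma quadForm_pos {a b : ℝ} (ha : 0 < a) (hb : 0 < b) (θ : ℝ) :
    0 < a ^ 2 * cos θ ^ 2 + b ^ 2 * sin θ ^ 2 := by
  rcases eq_or_ne (cos θ) 0 with h | h
  · have := cos_sq_add_sin_sq θ
    have h1 : sin θ ^ 2 = 1 := by simpa [h] using this
    rw [h1, h]; positivity
  · positivity

lemma continuous_gaussIntegrand {a b : ℝ} (ha : 0 < a) (hb : 0 < b) :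
    Continuous fun θ : ℝ ↦ (√(a ^ 2 * cos θ ^ 2 + b ^ 2 * sin θ ^ 2))⁻¹ := by
  refine Continuous.inv₀ (by fun_prop) fun θ ↦ ?_
  exact (sqrt_pos.2 (quadForm_pos ha hb θ)).ne'

lemma gaussIntegral_smul {c : ℝ} (hc : 0 < c) (a b : ℝ) :
    gaussIntegral (c * a) (c * b) = c⁻¹ * gaussIntegral a b := by
  rw [gaussIntegral, gaussIntegral, ← intervalIntegral.integral_const_mul]
  congr 1
  ext θ
  rw [show (c * a) ^ 2 * cos θ ^ 2 + (c * b) ^ 2 * sin θ ^ 2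
    = c ^ 2 * (a ^ 2 * cos θ ^ 2 + b ^ 2 * sin θ ^ 2) by ring, sqrt_mul (sq_nonneg c),
    sqrt_sq hc.le, mul_inv]

lemma gaussIntegral_one_one : gaussIntegral 1 1 = π / 2 := by
  simp [gaussIntegral]

/-- The amplitude substitution of the ascending Landen transformation. -/
noncomputable def landenAngle (a b φ : ℝ) : ℝ :=
  2 * φ - arctan ((a - b) * (sin φ * cos φ) / (a * cos φ ^ 2 + b * sin φ ^ 2))

lemma linForm_pos {a b : ℝ} (ha : 0 < a) (hb : 0 < b) (θ : ℝ) :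
    0 < a * cos θ ^ 2 + b * sin θ ^ 2 := by
  have := quadForm_pos (sqrt_pos.2 ha) (sqrt_pos.2 hb) θ
  rwa [sq_sqrt ha.le, sq_sqrt hb.le] at this

lemma hasDerivAt_landenAngle {a b : ℝ} (ha : 0 < a) (hb : 0 < b) (φ : ℝ) :
    HasDerivAt (landenAngle a b)
      ((a + b) * (a * cos φ ^ 2 + b * sin φ ^ 2) / (a ^ 2 * cos φ ^ 2 + b ^ 2 * sin φ ^ 2)) φ := by
  have hD := linForm_pos ha hb φ
  have hQ := quadForm_pos ha hb φ
  have hs := hasDerivAt_sin φ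
  have hc := hasDerivAt_cos φ
  have h := ((hasDerivAt_id φ).const_mul 2).sub
    ((((hs.mul hc).const_mul (a - b)).div
      (((hc.pow 2).const_mul a).add ((hs.pow 2).const_mul b)) hD.ne').arctan)
  refine h.congr_deriv ?_
  have e := sin_sq_add_cos_sq φ
  simp only [Pi.div_apply, Pi.mul_apply, Pi.add_apply, Pi.pow_apply]
  have key : (a * cos φ ^ 2 + b * sin φ ^ 2) ^ 2 + ((a - b) * (sin φ * cos φ)) ^ 2
      = a ^ 2 * cos φ ^ 2 + b ^ 2 * sin φ ^ 2 := by
    linear_combination (a ^ 2 * cos φ ^ 2 + b ^ 2 * sin φ ^ 2) * e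
  have h1 : 1 + ((a - b) * (sin φ * cos φ) / (a * cos φ ^ 2 + b * sin φ ^ 2)) ^ 2
      = (a ^ 2 * cos φ ^ 2 + b ^ 2 * sin φ ^ 2) / (a * cos φ ^ 2 + b * sin φ ^ 2) ^ 2 := by
    rw [← key]; field_simp
  rw [h1]
  set D := a * cos φ ^ 2 + b * sin φ ^ 2 with hDdef
  set Q := a ^ 2 * cos φ ^ 2 + b ^ 2 * sin φ ^ 2 with hQdef
  field_simp
  rw [hQdef, hDdef]
  simp only [Nat.cast_ofNat, Nat.add_one_sub_one, pow_one]
  have e' : sin φ ^ 2 = 1 - cos φ ^ 2 := by linarith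
  ring_nf
  simp only [show sin φ ^ 4 = (sin φ ^ 2) ^ 2 by ring, e']
  ring

lemma quadForm_landenAngle {a b : ℝ} (ha : 0 < a) (hb : 0 < b) (φ : ℝ) :
    ((a + b) / 2) ^ 2 * cos (landenAngle a b φ) ^ 2 +
      √(a * b) ^ 2 * sin (landenAngle a b φ) ^ 2 =
    ((a + b) / 2 * (a * cos φ ^ 2 + b * sin φ ^ 2)) ^ 2 /
      (a ^ 2 * cos φ ^ 2 + b ^ 2 * sin φ ^ 2) := by
  have hD := linForm_pos ha hb φ
  have hQ := quadForm_pos ha hb φ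
  have e := sin_sq_add_cos_sq φ
  rw [sq_sqrt (by positivity), landenAngle, cos_sub, sin_sub, cos_arctan, sin_arctan,
    sin_two_mul, cos_two_mul']
  have key : (a * cos φ ^ 2 + b * sin φ ^ 2) ^ 2 + ((a - b) * (sin φ * cos φ)) ^ 2
      = a ^ 2 * cos φ ^ 2 + b ^ 2 * sin φ ^ 2 := by
    linear_combination (a ^ 2 * cos φ ^ 2 + b ^ 2 * sin φ ^ 2) * e
  have h1 : 1 + ((a - b) * (sin φ * cos φ) / (a * cos φ ^ 2 + b * sin φ ^ 2)) ^ 2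
      = (a ^ 2 * cos φ ^ 2 + b ^ 2 * sin φ ^ 2) / (a * cos φ ^ 2 + b * sin φ ^ 2) ^ 2 := by
    rw [← key]; field_simp
  rw [h1, sqrt_div hQ.le, sqrt_sq hD.le]
  set D := a * cos φ ^ 2 + b * sin φ ^ 2 with hDdef
  set Q := a ^ 2 * cos φ ^ 2 + b ^ 2 * sin φ ^ 2 with hQdef
  have hR := sqrt_pos.2 hQ
  have hRQ := sq_sqrt hQ.le
  set R := √Q
  rw [← hRQ]
  have hc : (cos φ ^ 2 - sin φ ^ 2) * D + 2 * sin φ * cos φ * ((a - b) * (sin φ * cos φ))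
      = a * cos φ ^ 2 - b * sin φ ^ 2 := by
    rw [hDdef]; linear_combination (a * cos φ ^ 2 - b * sin φ ^ 2) * e
  have hs : 2 * sin φ * cos φ * D - (cos φ ^ 2 - sin φ ^ 2) * ((a - b) * (sin φ * cos φ))
      = (a + b) * (sin φ * cos φ) := by
    rw [hDdef]; linear_combination (a + b) * (sin φ * cos φ) * e
  have hc2 : (cos φ ^ 2 - sin φ ^ 2) * (1 / (R / D)) +
      2 * sin φ * cos φ * ((a - b) * (sin φ * cos φ) / D / (R / D))
      = (a * cos φ ^ 2 - b * sin φ ^ 2) / R := by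
    rw [← hc]; field_simp
  have hs2 : 2 * sin φ * cos φ * (1 / (R / D)) -
      (cos φ ^ 2 - sin φ ^ 2) * ((a - b) * (sin φ * cos φ) / D / (R / D))
      = (a + b) * (sin φ * cos φ) / R := by
    rw [← hs]; field_simp
  rw [hc2, hs2, hDdef]
  field_simp
  ring

/-- Gauss's invariance of the elliptic integral under one arithmetic-geometric mean step. -/
lemma gaussIntegral_agm {a b : ℝ} (ha : 0 < a) (hb : 0 < b) :
    gaussIntegral ((a + b) / 2) √(a * b) = gaussIntegral a b := by
  have ha' : 0 < (a + b) / 2 := by positivity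
  have hb' : 0 < √(a * b) := sqrt_pos.2 (by positivity)
  set g : ℝ → ℝ := fun θ ↦ (√(((a + b) / 2) ^ 2 * cos θ ^ 2 + √(a * b) ^ 2 * sin θ ^ 2))⁻¹
    with hg
  have hgc : Continuous g := continuous_gaussIntegrand ha' hb'
  have hsub : ∫ x in (0:ℝ)..(π/2), (g ∘ landenAngle a b) x *
      ((a + b) * (a * cos x ^ 2 + b * sin x ^ 2) / (a ^ 2 * cos x ^ 2 + b ^ 2 * sin x ^ 2))
      = ∫ x in (landenAngle a b 0)..(landenAngle a b (π/2)), g x := by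
    refine intervalIntegral.integral_comp_mul_deriv
      (fun x _ ↦ hasDerivAt_landenAngle ha hb x) ?_ hgc
    exact (Continuous.div (by fun_prop) (by fun_prop)
      fun x ↦ (quadForm_pos ha hb x).ne').continuousOn
  have hl0 : landenAngle a b 0 = 0 := by simp [landenAngle]
  have hl1 : landenAngle a b (π/2) = π := by simp [landenAngle]; ring
  have hleft : ∫ x in (0:ℝ)..(π/2), (g ∘ landenAngle a b) x *
      ((a + b) * (a * cos x ^ 2 + b * sin x ^ 2) / (a ^ 2 * cos x ^ 2 + b ^ 2 * sin x ^ 2))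
      = 2 * gaussIntegral a b := by
    rw [gaussIntegral, ← intervalIntegral.integral_const_mul]
    congr 1
    ext x
    have hD := linForm_pos ha hb x
    have hQ := quadForm_pos ha hb x
    simp only [hg, Function.comp]
    rw [quadForm_landenAngle ha hb, sqrt_div (sq_nonneg _), sqrt_sq (by positivity)]
    have hR := sqrt_pos.2 hQ
    have hRQ := sq_sqrt hQ.le
    set R := √(a ^ 2 * cos x ^ 2 + b ^ 2 * sin x ^ 2)
    rw [← hRQ]
    field_simp
  have hrefl : ∫ x in (π/2)..π, g x = ∫ x in (0:ℝ)..(π/2), g x := by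
    have := intervalIntegral.integral_comp_sub_left (a := 0) (b := π / 2) g π
    rw [show π - π / 2 = π / 2 by ring, sub_zero] at this
    rw [← this]
    congr 1
    ext x
    simp [hg, cos_pi_sub, sin_pi_sub]
  have hadd := intervalIntegral.integral_add_adjacent_intervals
    (hgc.intervalIntegrable 0 (π/2) (μ := MeasureTheory.volume)) (hgc.intervalIntegrable (π/2) π)
  rw [hl0, hl1, hleft, ← hadd, hrefl] at hsub
  have : gaussIntegral ((a + b) / 2) √(a * b) = ∫ x in (0:ℝ)..(π/2), g x := rfl
  linarith

lemma gaussIntegral_anti {a b a' b' : ℝ} (ha : 0 < a) (hb : 0 < b) (ha' : a ≤ a')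
    (hb' : b ≤ b') : gaussIntegral a' b' ≤ gaussIntegral a b := by
  refine intervalIntegral.integral_mono_on (by positivity)
    ((continuous_gaussIntegrand (ha.trans_le ha') (hb.trans_le hb')).intervalIntegrable _ _)
    ((continuous_gaussIntegrand ha hb).intervalIntegrable _ _) fun θ _ ↦ ?_
  have := quadForm_pos ha hb θ
  gcongr

lemma gaussIntegral_self {c : ℝ} (hc : 0 < c) : gaussIntegral c c = c⁻¹ * (π / 2) := by
  have := gaussIntegral_smul hc 1 1
  rwa [mul_one, gaussIntegral_one_one] at this

lemma tendsto_gaussIntegral {a b : ℕ → ℝ} (ha : ∀ n, 0 < a n) (hb : ∀ n, 0 < b n)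
    (hla : Tendsto a atTop (𝓝 1)) (hlb : Tendsto b atTop (𝓝 1)) :
    Tendsto (fun n ↦ gaussIntegral (a n) (b n)) atTop (𝓝 (π / 2)) := by
  have hmax : Tendsto (fun n ↦ (max (a n) (b n))⁻¹ * (π / 2)) atTop (𝓝 (π / 2)) := by
    have := ((hla.max hlb).inv₀ (by simp)).mul_const (π / 2)
    simpa using this
  have hmin : Tendsto (fun n ↦ (min (a n) (b n))⁻¹ * (π / 2)) atTop (𝓝 (π / 2)) := by
    have := ((hla.min hlb).inv₀ (by simp)).mul_const (π / 2)
    simpa using this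
  refine tendsto_of_tendsto_of_tendsto_of_le_of_le hmax hmin (fun n ↦ ?_) fun n ↦ ?_
  · rw [← gaussIntegral_self (lt_max_of_lt_left (ha n))]
    exact gaussIntegral_anti (ha n) (hb n) (le_max_left _ _) (le_max_right _ _)
  · rw [← gaussIntegral_self (lt_min (ha n) (hb n))]
    exact gaussIntegral_anti (lt_min (ha n) (hb n)) (lt_min (ha n) (hb n))
      (min_le_left _ _) (min_le_right _ _)

lemma ellK_eq_gaussIntegral {x y : ℝ} (h : x ^ 2 + y ^ 2 = 1) : ellK x = gaussIntegral 1 y := by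
  rw [ellK, gaussIntegral]
  congr 1
  ext θ
  have e : 1 - x ^ 2 * sin θ ^ 2 = 1 ^ 2 * cos θ ^ 2 + y ^ 2 * sin θ ^ 2 := by
    linear_combination - sin_sq_add_cos_sq θ - sin θ ^ 2 * h
  rw [e, neg_div, rpow_neg (by positivity), sqrt_eq_rpow]

lemma ellK_lt_ellK {x y : ℝ} (hx : 0 ≤ x) (hxy : x < y) (hy : y < 1) : ellK x < ellK y := by
  have hpos : ∀ z : ℝ, 0 ≤ z → z < 1 → ∀ θ : ℝ, 0 < 1 - z ^ 2 * sin θ ^ 2 := fun z h0 h1 θ ↦ by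
    have h2 : z ^ 2 < 1 := by nlinarith
    nlinarith [sin_sq_le_one θ, sq_nonneg (sin θ), sq_nonneg z]
  have hcont : ∀ z : ℝ, 0 ≤ z → z < 1 →
      Continuous fun θ : ℝ ↦ (1 - z ^ 2 * sin θ ^ 2) ^ (-(1:ℝ)/2) := fun z h0 h1 ↦
    Continuous.rpow_const (by fun_prop) fun θ ↦ Or.inl (hpos z h0 h1 θ).ne'
  have hy0 := hx.trans hxy.le
  refine intervalIntegral.integral_lt_integral_of_continuousOn_of_le_of_exists_lt (by positivity)
    (hcont x hx (hxy.trans hy)).continuousOn (hcont y hy0 hy).continuousOn (fun θ _ ↦ ?_)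
    ⟨π / 2, ⟨by positivity, le_rfl⟩, ?_⟩
  · exact rpow_le_rpow_of_nonpos (hpos y hy0 hy θ) (by gcongr) (by norm_num)
  · refine rpow_lt_rpow_of_neg (hpos y hy0 hy _) ?_ (by norm_num)
    simp only [sin_pi_div_two]
    nlinarith

/-- The singular modulus is unique. -/
lemma singular_modulus_unique {s k l : ℝ} (hs : 0 < s) (hk0 : 0 < k) (hk1 : k < 1) (hl0 : 0 < l)
    (hl1 : l < 1) (hk : ellK √(1 - k ^ 2) = s * ellK k) (hl : ellK √(1 - l ^ 2) = s * ellK l) :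
    k = l := by
  have key : ∀ x y : ℝ, 0 < x → y < 1 → x < y → ellK √(1 - x ^ 2) = s * ellK x →
      ellK √(1 - y ^ 2) ≠ s * ellK y := fun x y hx hy hxy h1 h2 ↦ by
    have h3 := ellK_lt_ellK hx.le hxy hy
    have h4 : ellK √(1 - y ^ 2) < ellK √(1 - x ^ 2) := by
      refine ellK_lt_ellK (sqrt_nonneg _) (sqrt_lt_sqrt (by nlinarith) (by nlinarith)) ?_
      rw [sqrt_lt' one_pos]
      nlinarith
    rw [h1, h2] at h4
    exact absurd h4 (not_lt.2 (by gcongr))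
  rcases lt_trichotomy k l with h | h | h
  · exact absurd hl (key k l hk0 hl1 h hk)
  · exact h
  · exact absurd hk (key l k hl0 hk1 h hl)

/-- The infinite `q`-Pochhammer product `(-a; x)_∞ = ∏_{n ≥ 0} (1 + a xⁿ)`. -/
noncomputable def qPoch (a x : ℝ) : ℝ := ∏' n : ℕ, (1 + a * x ^ n)

lemma summable_mul_pow {x : ℝ} (hx0 : 0 ≤ x) (hx1 : x < 1) (a : ℝ) :
    Summable fun n : ℕ ↦ a * x ^ n :=
  (summable_geometric_of_lt_one hx0 hx1).mul_left a

lemma hasProd_qPoch {x : ℝ} (hx0 : 0 ≤ x) (hx1 : x < 1) (a : ℝ) :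
    HasProd (fun n : ℕ ↦ 1 + a * x ^ n) (qPoch a x) :=
  (Real.multipliable_one_add_of_summable (summable_mul_pow hx0 hx1 a)).hasProd

lemma qPoch_pos {x a : ℝ} (hx0 : 0 ≤ x) (hx1 : x < 1) (ha : -1 < a) : 0 < qPoch a x := by
  have hpos : ∀ n : ℕ, 0 < 1 + a * x ^ n := fun n ↦ by
    have h1 : x ^ n ≤ 1 := pow_le_one₀ hx0 hx1.le
    have h0 : 0 ≤ x ^ n := by positivity
    rcases le_total 0 a with h | h
    · positivity
    · nlinarith
  rw [qPoch, ← Real.rexp_tsum_eq_tprod hpos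
    (Real.summable_log_one_add_of_summable (summable_mul_pow hx0 hx1 a))]
  exact exp_pos _

lemma qPoch_even_mul_odd {x : ℝ} (hx0 : 0 ≤ x) (hx1 : x < 1) (a : ℝ) :
    qPoch a x = qPoch a (x ^ 2) * qPoch (a * x) (x ^ 2) := by
  have h20 : 0 ≤ x ^ 2 := by positivity
  have h21 : x ^ 2 < 1 := by nlinarith
  refine (hasProd_qPoch hx0 hx1 a).unique (HasProd.even_mul_odd ?_ ?_)
  · convert hasProd_qPoch h20 h21 a using 3 with n
    rw [pow_mul]
  · convert hasProd_qPoch h20 h21 (a * x) using 3 with n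
    rw [pow_succ, pow_mul]; ring

lemma qPoch_mul_neg {x : ℝ} (hx0 : 0 ≤ x) (hx1 : x < 1) (a : ℝ) :
    qPoch a x * qPoch (-a) x = qPoch (-a ^ 2) (x ^ 2) := by
  have h20 : 0 ≤ x ^ 2 := by positivity
  have h21 : x ^ 2 < 1 := by nlinarith
  refine ((hasProd_qPoch hx0 hx1 a).mul (hasProd_qPoch hx0 hx1 (-a))).unique ?_
  convert hasProd_qPoch h20 h21 (-a ^ 2) using 2 with n
  rw [← pow_mul, mul_comm 2 n, pow_mul]; ring

lemma qPoch_eq_mul {x : ℝ} (hx0 : 0 ≤ x) (hx1 : x < 1) (a : ℝ) :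
    qPoch a x = (1 + a) * qPoch (a * x) x := by
  rw [qPoch, tprod_eq_zero_mul']
  · simp [qPoch, pow_succ', mul_assoc]
  · simpa [pow_succ', mul_assoc] using
      Real.multipliable_one_add_of_summable (summable_mul_pow hx0 hx1 (a * x))

/-- The Gaussian binomial coefficient, by its Pascal recursion. -/
def gaussBinom (x : ℝ) : ℕ → ℕ → ℝ
  | _, 0 => 1
  | 0, _ + 1 => 0
  | n + 1, k + 1 => gaussBinom x n k + x ^ (k + 1) * gaussBinom x n (k + 1)

@[simp] lemma gaussBinom_zero_right (x : ℝ) (n : ℕ) : gaussBinom x n 0 = 1 := by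
  cases n <;> rfl

lemma gaussBinom_succ_succ (x : ℝ) (n k : ℕ) : gaussBinom x (n + 1) (k + 1) =
    gaussBinom x n k + x ^ (k + 1) * gaussBinom x n (k + 1) := rfl

lemma gaussBinom_of_lt (x : ℝ) : ∀ {n k : ℕ}, n < k → gaussBinom x n k = 0
  | _, 0, h => absurd h (by simp)
  | 0, _ + 1, _ => rfl
  | n + 1, k + 1, h => by
    rw [gaussBinom_succ_succ, gaussBinom_of_lt x (by omega), gaussBinom_of_lt x (by omega)]
    simp

/-- The finite product `(x; x)_n`. -/
def qFact (x : ℝ) (n : ℕ) : ℝ := ∏ i ∈ Finset.range n, (1 - x ^ (i + 1))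

lemma qFact_succ (x : ℝ) (n : ℕ) : qFact x (n + 1) = qFact x n * (1 - x ^ (n + 1)) :=
  Finset.prod_range_succ _ _

lemma gaussBinom_mul_qFact (x : ℝ) : ∀ m k : ℕ,
    gaussBinom x (m + k) k * (qFact x m * qFact x k) = qFact x (m + k)
  | m, 0 => by simp [qFact]
  | 0, k + 1 => by
    have ih := gaussBinom_mul_qFact x 0 k
    rw [zero_add] at ih ⊢
    rw [gaussBinom_succ_succ, gaussBinom_of_lt x (Nat.lt_succ_self k), qFact_succ]
    linear_combination (1 - x ^ (k + 1)) * ih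
  | m + 1, k + 1 => by
    have ih1 := gaussBinom_mul_qFact x (m + 1) k
    have ih2 := gaussBinom_mul_qFact x m (k + 1)
    rw [show m + 1 + (k + 1) = (m + k + 1) + 1 by ring, gaussBinom_succ_succ]
    rw [show m + 1 + k = m + k + 1 by ring] at ih1
    rw [show m + (k + 1) = m + k + 1 by ring] at ih2
    rw [qFact_succ x (m + k + 1)]
    rw [qFact_succ x m] at ih1 ⊢
    rw [qFact_succ x k] at ih2 ⊢
    linear_combination (1 - x ^ (k + 1)) * ih1 + x ^ (k + 1) * (1 - x ^ (m + 1)) * ih2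

/-- The finite `q`-binomial theorem. -/
lemma prod_one_add_eq_sum_gaussBinom (q : ℝ) (n : ℕ) : ∀ a : ℝ,
    ∏ i ∈ Finset.range n, (1 + a * q ^ (2 * i + 1)) =
      ∑ k ∈ Finset.range (n + 1), gaussBinom (q ^ 2) n k * q ^ (k ^ 2) * a ^ k := by
  induction n with
  | zero => intro a; simp
  | succ n ih =>
    intro a
    rw [Finset.prod_range_succ']
    have h1 : ∏ i ∈ Finset.range n, (1 + a * q ^ (2 * (i + 1) + 1)) =
        ∏ i ∈ Finset.range n, (1 + (a * q ^ 2) * q ^ (2 * i + 1)) :=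
      Finset.prod_congr rfl fun i _ ↦ by ring
    rw [h1, ih, Finset.sum_range_succ' _ (n + 1)]
    have h2 : ∑ k ∈ Finset.range (n + 1), gaussBinom (q ^ 2) n k * q ^ (k ^ 2) * (a * q ^ 2) ^ k
        = ∑ k ∈ Finset.range (n + 1), gaussBinom (q ^ 2) n (k + 1) * q ^ ((k + 1) ^ 2) *
          (a * q ^ 2) ^ (k + 1) + 1 := by
      have := Finset.sum_range_succ' (fun k ↦ gaussBinom (q ^ 2) n k * q ^ (k ^ 2) *
        (a * q ^ 2) ^ k) (n + 1)
      rw [Finset.sum_range_succ, gaussBinom_of_lt _ (Nat.lt_succ_self n)] at this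
      simpa using this
    rw [mul_add, mul_one]
    nth_rewrite 1 [h2]
    simp only [gaussBinom_zero_right]
    rw [Finset.sum_mul, add_right_comm, ← Finset.sum_add_distrib]
    simp only [ne_eq, OfNat.ofNat_ne_zero, not_false_eq_true, zero_pow, pow_zero, mul_one]
    congr 1
    refine Finset.sum_congr rfl fun k _ ↦ ?_
    rw [gaussBinom_succ_succ]
    ring

lemma prod_one_add_div (q z : ℝ) (hq : q ≠ 0) (hz : z ≠ 0) (N : ℕ) :
    ∏ i ∈ Finset.range N, (1 + z / q ^ (2 * N) * q ^ (2 * i + 1)) =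
      z ^ N / q ^ (N ^ 2) * ∏ i ∈ Finset.range N, (1 + z⁻¹ * q ^ (2 * i + 1)) := by
  induction N with
  | zero => simp
  | succ N ih =>
    rw [Finset.prod_range_succ', Finset.prod_range_succ]
    have h1 : ∏ i ∈ Finset.range N, (1 + z / q ^ (2 * (N + 1)) * q ^ (2 * (i + 1) + 1)) =
        ∏ i ∈ Finset.range N, (1 + z / q ^ (2 * N) * q ^ (2 * i + 1)) :=
      Finset.prod_congr rfl fun i _ ↦ by field_simp; ring
    rw [h1, ih]
    set A := ∏ i ∈ Finset.range N, (1 + z⁻¹ * q ^ (2 * i + 1))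
    have h2 : 1 + z / q ^ (2 * (N + 1)) * q ^ (2 * 0 + 1) =
        z / q ^ (2 * N + 1) * (1 + z⁻¹ * q ^ (2 * N + 1)) := by
      field_simp
      ring
    rw [h2, show q ^ (N + 1) ^ 2 = q ^ N ^ 2 * q ^ (2 * N + 1) by ring, pow_succ z N]
    field_simp

/-- The finite Jacobi triple product (Cauchy). -/
lemma finite_triple_product (q z : ℝ) (hq : q ≠ 0) (hz : z ≠ 0) (N : ℕ) :
    (∏ i ∈ Finset.range N, (1 + z⁻¹ * q * (q ^ 2) ^ i)) *
      ∏ i ∈ Finset.range N, (1 + z * q * (q ^ 2) ^ i) =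
      ∑ j ∈ Finset.Icc (-N : ℤ) N,
        gaussBinom (q ^ 2) (2 * N) (j + N).toNat * (q ^ (j ^ 2) * z ^ j) := by
  have h := prod_one_add_eq_sum_gaussBinom q (N + N) (z / q ^ (2 * N))
  rw [Finset.prod_range_add, prod_one_add_div q z hq hz] at h
  have h1 : ∏ i ∈ Finset.range N, (1 + z / q ^ (2 * N) * q ^ (2 * (N + i) + 1)) =
      ∏ i ∈ Finset.range N, (1 + z * q * (q ^ 2) ^ i) :=
    Finset.prod_congr rfl fun i _ ↦ by field_simp; ring
  have h2 : ∏ i ∈ Finset.range N, (1 + z⁻¹ * q ^ (2 * i + 1)) =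
      ∏ i ∈ Finset.range N, (1 + z⁻¹ * q * (q ^ 2) ^ i) :=
    Finset.prod_congr rfl fun i _ ↦ by ring
  rw [h1, h2, mul_assoc, ← eq_inv_mul_iff_mul_eq₀ (by positivity), Finset.mul_sum] at h
  rw [h]
  refine Finset.sum_nbij' (fun k ↦ (k : ℤ) - N) (fun j ↦ (j + N).toNat) ?_ ?_ ?_ ?_ ?_
  · intro k hk; simp at hk ⊢; omega
  · intro k hk; simp at hk ⊢; omega
  · intro k hk; simp
  · intro k hk; simp at hk ⊢; omega
  · intro k hk
    simp only [sub_add_cancel, Int.toNat_natCast]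
    rw [zpow_sub₀ hz, show ((k : ℤ) - N) ^ 2 = (k ^ 2 : ℕ) + (N ^ 2 : ℕ) - (2 * N * k : ℕ) by
      push_cast; ring, zpow_sub₀ hq, zpow_add₀ hq]
    simp only [zpow_natCast]
    rw [div_pow, ← pow_mul, two_mul N]
    field_simp

lemma summable_zpow_sq {q : ℝ} (hq0 : 0 < q) (hq1 : q < 1) (z : ℝ) :
    Summable fun j : ℤ ↦ q ^ (j ^ 2) * z ^ j := by
  rcases eq_or_ne z 0 with rfl | hz
  · refine summable_of_ne_finset_zero (s := {0}) fun b hb ↦ ?_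
    rw [zero_zpow _ (by simpa using hb), mul_zero]
  have hl : 0 < -log q / π := div_pos (neg_pos.2 (log_neg hq0 hq1)) pi_pos
  have h := summable_pow_mul_jacobiTheta₂_term_bound (abs (log |z|) / (2 * π)) hl 0
  refine Summable.of_norm_bounded h fun j ↦ ?_
  rw [norm_mul, norm_zpow, norm_zpow, norm_eq_abs, norm_eq_abs, abs_of_pos hq0, pow_zero, one_mul,
    ← exp_log hq0, ← exp_log (abs_pos.2 hz), ← rpow_intCast, ← rpow_intCast, ← exp_mul,
    ← exp_mul, ← exp_add, exp_le_exp,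
    log_exp, log_exp]
  have h1 : (j : ℝ) * log |z| ≤ |(j : ℝ)| * abs (log |z|) := by
    rw [← abs_mul]; exact le_abs_self _
  push_cast
  field_simp
  linarith

lemma qFact_pos {x : ℝ} (hx0 : 0 ≤ x) (hx1 : x < 1) (n : ℕ) : 0 < qFact x n :=
  Finset.prod_pos fun _ _ ↦ sub_pos.2 (pow_lt_one₀ hx0 hx1 (by omega))

lemma qFact_le_one {x : ℝ} (hx0 : 0 ≤ x) (hx1 : x < 1) (n : ℕ) : qFact x n ≤ 1 :=
  Finset.prod_le_one (fun _ _ ↦ sub_nonneg.2 (pow_le_one₀ hx0 hx1.le))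
    fun _ _ ↦ sub_le_self _ (by positivity)

lemma tendsto_qFact {x : ℝ} (hx0 : 0 ≤ x) (hx1 : x < 1) :
    Tendsto (qFact x) atTop (𝓝 (qPoch (-x) x)) := by
  convert (hasProd_qPoch hx0 hx1 (-x)).tendsto_prod_nat using 2 with n
  exact Finset.prod_congr rfl fun i _ ↦ by ring

lemma qPoch_le_qFact {x : ℝ} (hx0 : 0 ≤ x) (hx1 : x < 1) (n : ℕ) :
    qPoch (-x) x ≤ qFact x n := by
  refine Antitone.le_of_tendsto (antitone_nat_of_succ_le fun n ↦ ?_) (tendsto_qFact hx0 hx1) n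
  rw [qFact_succ]
  exact mul_le_of_le_one_right (qFact_pos hx0 hx1 n).le (sub_le_self _ (by positivity))

lemma gaussBinom_eq {x : ℝ} (hx0 : 0 ≤ x) (hx1 : x < 1) (m k : ℕ) :
    gaussBinom x (m + k) k = qFact x (m + k) / (qFact x m * qFact x k) := by
  rw [eq_div_iff (mul_pos (qFact_pos hx0 hx1 m) (qFact_pos hx0 hx1 k)).ne', gaussBinom_mul_qFact]

/-- **Jacobi triple product.** -/
theorem jacobi_triple_product {q z : ℝ} (hq0 : 0 < q) (hq1 : q < 1) (hz : z ≠ 0) :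
    ∑' j : ℤ, q ^ (j ^ 2) * z ^ j =
      qPoch (-q ^ 2) (q ^ 2) * (qPoch (z⁻¹ * q) (q ^ 2) * qPoch (z * q) (q ^ 2)) := by
  have hx0 : 0 ≤ q ^ 2 := by positivity
  have hx1 : q ^ 2 < 1 := by nlinarith
  set P := qPoch (-q ^ 2) (q ^ 2) with hP
  have hP0 : 0 < P := qPoch_pos hx0 hx1 (by linarith)
  set f : ℕ → ℤ → ℝ := fun N j ↦ if j ∈ Finset.Icc (-N : ℤ) N then
    gaussBinom (q ^ 2) (2 * N) (j + N).toNat * (q ^ (j ^ 2) * z ^ j) else 0 with hf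
  have hcoef : ∀ (N : ℕ) (j : ℤ), j ∈ Finset.Icc (-N : ℤ) N →
      gaussBinom (q ^ 2) (2 * N) (j + N).toNat = qFact (q ^ 2) (2 * N) /
        (qFact (q ^ 2) (N - j).toNat * qFact (q ^ 2) (j + N).toNat) := fun N j hj ↦ by
    rw [Finset.mem_Icc] at hj
    have := gaussBinom_eq hx0 hx1 (N - j).toNat (j + N).toNat
    rwa [show (N - j).toNat + (j + N).toNat = 2 * N by omega] at this
  have hL : Tendsto (fun N : ℕ ↦ ∑' j, f N j) atTop
      (𝓝 (qPoch (z⁻¹ * q) (q ^ 2) * qPoch (z * q) (q ^ 2))) := by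
    convert (hasProd_qPoch hx0 hx1 (z⁻¹ * q)).tendsto_prod_nat.mul
      (hasProd_qPoch hx0 hx1 (z * q)).tendsto_prod_nat using 2 with N
    rw [finite_triple_product q z hq0.ne' hz, tsum_eq_sum (s := Finset.Icc (-N : ℤ) N)]
    · exact Finset.sum_congr rfl fun j hj ↦ if_pos hj
    · intro j hj; exact if_neg hj
  have hR : Tendsto (fun N : ℕ ↦ ∑' j, f N j) atTop
      (𝓝 (∑' j : ℤ, P⁻¹ * (q ^ (j ^ 2) * z ^ j))) := by
    refine tendsto_tsum_of_dominated_convergence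
      (bound := fun j ↦ (P * P)⁻¹ * ‖q ^ (j ^ 2) * z ^ j‖)
      ((summable_zpow_sq hq0 hq1 z).norm.mul_left _) (fun j ↦ ?_)
      (Eventually.of_forall fun N j ↦ ?_)
    · have h1 : Tendsto (fun N : ℕ ↦ qFact (q ^ 2) (2 * N)) atTop (𝓝 P) :=
        (tendsto_qFact hx0 hx1).comp (tendsto_id.const_mul_atTop' two_pos)
      have h2 : Tendsto (fun N : ℕ ↦ qFact (q ^ 2) ((N : ℤ) - j).toNat) atTop (𝓝 P) := by
        refine (tendsto_qFact hx0 hx1).comp (tendsto_atTop.2 fun b ↦ ?_)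
        filter_upwards [eventually_ge_atTop (b + j.natAbs)] with N hN
        omega
      have h3 : Tendsto (fun N : ℕ ↦ qFact (q ^ 2) (j + (N : ℤ)).toNat) atTop (𝓝 P) := by
        refine (tendsto_qFact hx0 hx1).comp (tendsto_atTop.2 fun b ↦ ?_)
        filter_upwards [eventually_ge_atTop (b + j.natAbs)] with N hN
        omega
      have h4 := (h1.div (h2.mul h3) (by positivity)).mul_const (q ^ (j ^ 2) * z ^ j)
      rw [show P / (P * P) = P⁻¹ by field_simp] at h4
      refine h4.congr' ?_
      filter_upwards [eventually_ge_atTop j.natAbs] with N hN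
      have hj : j ∈ Finset.Icc (-N : ℤ) N := by rw [Finset.mem_Icc]; omega
      rw [hf]
      simp only [if_pos hj]
      rw [hcoef N j hj]
      rfl
    · by_cases hj : j ∈ Finset.Icc (-N : ℤ) N
      · simp only [hf, if_pos hj]
        rw [norm_mul, hcoef N j hj]
        refine mul_le_mul_of_nonneg_right ?_ (norm_nonneg _)
        have a1 := qFact_pos hx0 hx1 (2 * N)
        have a2 := qFact_pos hx0 hx1 (N - j).toNat
        have a3 := qFact_pos hx0 hx1 (j + N).toNat
        rw [norm_of_nonneg (by positivity), div_eq_mul_inv]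
        refine (mul_le_of_le_one_left (by positivity) (qFact_le_one hx0 hx1 _)).trans ?_
        gcongr <;> exact qPoch_le_qFact hx0 hx1 _
      · simp only [hf, if_neg hj, norm_zero]
        positivity
  have := tendsto_nhds_unique hL hR
  rw [tsum_mul_left] at this
  rw [this]
  field_simp

/-- `θ₂` at the nome `e^{-πt}`. -/
noncomputable def thetaTwo (t : ℝ) : ℝ := ∑' n : ℤ, exp (-π * t * ((n : ℝ) + 1 / 2) ^ 2)

/-- `θ₃` at the nome `e^{-πt}`. -/
noncomputable def thetaThree (t : ℝ) : ℝ := ∑' n : ℤ, exp (-π * t * (n : ℝ) ^ 2)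

/-- `θ₄` at the nome `e^{-πt}`. -/
noncomputable def thetaFour (t : ℝ) : ℝ := ∑' n : ℤ, (-1 : ℝ) ^ n * exp (-π * t * (n : ℝ) ^ 2)

lemma exp_neg_pi_mul_lt_one {t : ℝ} (ht : 0 < t) : exp (-π * t) < 1 :=
  Real.exp_lt_one_iff.2 (by nlinarith [pi_pos])

lemma exp_theta_term (t : ℝ) (n : ℤ) : exp (-π * t * (n : ℝ) ^ 2) = exp (-π * t) ^ (n ^ 2) := by
  rw [← rpow_intCast, ← exp_mul]; push_cast; rfl

lemma exp_theta_half_term (t : ℝ) (n : ℤ) : exp (-π * t * ((n : ℝ) + 1 / 2) ^ 2) =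
    exp (-π * t / 4) * (exp (-π * t) ^ (n ^ 2) * exp (-π * t) ^ n) := by
  rw [← rpow_intCast, ← rpow_intCast, ← exp_mul, ← exp_mul, ← exp_add, ← exp_add]
  push_cast
  ring_nf

lemma summable_thetaThree {t : ℝ} (ht : 0 < t) :
    Summable fun n : ℤ ↦ exp (-π * t * (n : ℝ) ^ 2) := by
  simp only [exp_theta_term]
  simpa using summable_zpow_sq (exp_pos _) (exp_neg_pi_mul_lt_one ht) 1

lemma summable_thetaFour {t : ℝ} (ht : 0 < t) :
    Summable fun n : ℤ ↦ (-1 : ℝ) ^ n * exp (-π * t * (n : ℝ) ^ 2) := by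
  simp only [exp_theta_term, mul_comm ((-1 : ℝ) ^ (_ : ℤ))]
  exact summable_zpow_sq (exp_pos _) (exp_neg_pi_mul_lt_one ht) (-1)

lemma summable_thetaTwo {t : ℝ} (ht : 0 < t) :
    Summable fun n : ℤ ↦ exp (-π * t * ((n : ℝ) + 1 / 2) ^ 2) := by
  simp only [exp_theta_half_term]
  exact (summable_zpow_sq (exp_pos _) (exp_neg_pi_mul_lt_one ht) _).mul_left _

lemma thetaThree_eq_prod {t q : ℝ} (ht : 0 < t) (hq : q = exp (-π * t)) :
    thetaThree t = qPoch (-q ^ 2) (q ^ 2) * qPoch q (q ^ 2) ^ 2 := by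
  have := jacobi_triple_product (z := 1) (exp_pos _) (exp_neg_pi_mul_lt_one ht) one_ne_zero
  simp only [thetaThree, exp_theta_term]
  rw [← hq] at this ⊢
  simpa only [one_zpow, mul_one, inv_one, one_mul, ← sq] using this

lemma thetaFour_eq_prod {t q : ℝ} (ht : 0 < t) (hq : q = exp (-π * t)) :
    thetaFour t = qPoch (-q ^ 2) (q ^ 2) * qPoch (-q) (q ^ 2) ^ 2 := by
  have := jacobi_triple_product (z := -1) (exp_pos _) (exp_neg_pi_mul_lt_one ht) (by norm_num)
  simp only [thetaFour, exp_theta_term, mul_comm ((-1 : ℝ) ^ (_ : ℤ))]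
  rw [← hq] at this ⊢
  rw [this, inv_neg, inv_one, neg_one_mul, ← sq]

lemma thetaTwo_eq_prod {t q : ℝ} (ht : 0 < t) (hq : q = exp (-π * t)) :
    thetaTwo t =
      exp (-π * t / 4) * (qPoch (-q ^ 2) (q ^ 2) * (2 * qPoch (q ^ 2) (q ^ 2) ^ 2)) := by
  have hq0 : 0 < q := hq ▸ exp_pos _
  have hq1 : q < 1 := hq ▸ exp_neg_pi_mul_lt_one ht
  have := jacobi_triple_product (z := q) hq0 hq1 hq0.ne'
  simp only [thetaTwo, exp_theta_half_term]
  rw [tsum_mul_left, ← hq, this, inv_mul_cancel₀ hq0.ne',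
    qPoch_eq_mul (by positivity) (by nlinarith) 1]
  ring_nf

lemma thetaThree_pos {t : ℝ} (ht : 0 < t) : 0 < thetaThree t :=
  (summable_thetaThree ht).tsum_pos (fun _ ↦ (exp_pos _).le) 0 (exp_pos _)

lemma thetaTwo_pos {t : ℝ} (ht : 0 < t) : 0 < thetaTwo t :=
  (summable_thetaTwo ht).tsum_pos (fun _ ↦ (exp_pos _).le) 0 (exp_pos _)

lemma thetaFour_pos {t : ℝ} (ht : 0 < t) : 0 < thetaFour t := by
  have h0 := exp_pos (-π * t)
  have h1 := exp_neg_pi_mul_lt_one ht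
  have h2 : exp (-π * t) ^ 2 < 1 := by nlinarith
  rw [thetaFour_eq_prod ht rfl]
  exact mul_pos (qPoch_pos (by positivity) h2 (by linarith))
    (pow_pos (qPoch_pos (by positivity) h2 (by linarith)) 2)

lemma tsum_even_lattice {f : ℤ × ℤ → ℝ} (c : ℤ)
    (hf : ∀ p : ℤ × ℤ, (p.1 + p.2 - c) % 2 ≠ 0 → f p = 0) :
    ∑' p, f p = ∑' p : ℤ × ℤ, f (p.1 + p.2 + c, p.1 - p.2) := by
  have hg : Function.Injective fun p : ℤ × ℤ ↦ (p.1 + p.2 + c, p.1 - p.2) := by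
    rintro ⟨a, b⟩ ⟨a', b'⟩ h
    simp only [Prod.mk.injEq] at h ⊢
    omega
  refine (hg.tsum_eq fun p hp ↦ ?_).symm
  have : (p.1 + p.2 - c) % 2 = 0 := by_contra fun h ↦ hp (hf p h)
  refine ⟨((p.1 + p.2 - c) / 2, (p.1 - p.2 - c) / 2), ?_⟩
  ext <;> simp only <;> omega

lemma neg_one_zpow_add_eq_neg_one {m n : ℤ} (h : (m + n) % 2 ≠ 0) :
    (-1 : ℝ) ^ m * (-1 : ℝ) ^ n = -1 := by
  rw [← zpow_add₀ (by norm_num)]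
  exact Odd.neg_one_zpow (Int.odd_iff.2 (by omega))

lemma neg_one_zpow_add_eq_one {m n : ℤ} (h : (m + n) % 2 = 0) :
    (-1 : ℝ) ^ m * (-1 : ℝ) ^ n = 1 := by
  rw [← zpow_add₀ (by norm_num)]
  exact Even.neg_one_zpow (Int.even_iff.2 h)

lemma tsum_mul_tsum_prod {f g : ℤ → ℝ} (hf : Summable f) (hg : Summable g) :
    HasSum (fun p : ℤ × ℤ ↦ f p.1 * g p.2) ((∑' n, f n) * ∑' n, g n) := by
  rw [tsum_mul_tsum_of_summable_norm hf.norm hg.norm]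
  exact (summable_mul_of_summable_norm hf.norm hg.norm).hasSum

lemma thetaThree_sq_add_thetaFour_sq {t : ℝ} (ht : 0 < t) :
    thetaThree t ^ 2 + thetaFour t ^ 2 = 2 * thetaThree (2 * t) ^ 2 := by
  have h3 := tsum_mul_tsum_prod (summable_thetaThree ht) (summable_thetaThree ht)
  have h4 := tsum_mul_tsum_prod (summable_thetaFour ht) (summable_thetaFour ht)
  have h2 := tsum_mul_tsum_prod (summable_thetaThree (mul_pos two_pos ht))
    (summable_thetaThree (mul_pos two_pos ht))
  have h34 := (h3.add h4).tsum_eq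
  rw [thetaThree, thetaFour, thetaThree, sq, sq, sq, ← h34, ← (h2.mul_left 2).tsum_eq,
    tsum_even_lattice 0]
  · refine tsum_congr fun p ↦ ?_
    rw [mul_mul_mul_comm, neg_one_zpow_add_eq_one (by omega), one_mul, ← two_mul, ← exp_add,
      ← exp_add]
    push_cast
    ring_nf
  · intro p hp
    rw [mul_mul_mul_comm, neg_one_zpow_add_eq_neg_one (by omega)]
    ring

lemma thetaThree_sq_sub_thetaFour_sq {t : ℝ} (ht : 0 < t) :
    thetaThree t ^ 2 - thetaFour t ^ 2 = 2 * thetaTwo (2 * t) ^ 2 := by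
  have h3 := tsum_mul_tsum_prod (summable_thetaThree ht) (summable_thetaThree ht)
  have h4 := tsum_mul_tsum_prod (summable_thetaFour ht) (summable_thetaFour ht)
  have h2 := tsum_mul_tsum_prod (summable_thetaTwo (mul_pos two_pos ht))
    (summable_thetaTwo (mul_pos two_pos ht))
  have h34 := (h3.sub h4).tsum_eq
  rw [thetaThree, thetaFour, thetaTwo, sq, sq, sq, ← h34, ← (h2.mul_left 2).tsum_eq,
    tsum_even_lattice 1]
  · refine tsum_congr fun p ↦ ?_
    rw [mul_mul_mul_comm, neg_one_zpow_add_eq_neg_one (by omega), neg_one_mul, sub_neg_eq_add,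
      ← two_mul, ← exp_add, ← exp_add]
    push_cast
    ring_nf
  · intro p hp
    rw [mul_mul_mul_comm, neg_one_zpow_add_eq_one (by omega)]
    ring

lemma thetaThree_mul_thetaFour {t : ℝ} (ht : 0 < t) :
    thetaThree t * thetaFour t = thetaFour (2 * t) ^ 2 := by
  have h34 := tsum_mul_tsum_prod (summable_thetaThree ht) (summable_thetaFour ht)
  have h43 := tsum_mul_tsum_prod (summable_thetaFour ht) (summable_thetaThree ht)
  have h2 := tsum_mul_tsum_prod (summable_thetaFour (mul_pos two_pos ht))
    (summable_thetaFour (mul_pos two_pos ht))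
  have h := (h34.add h43).tsum_eq
  suffices H : thetaThree t * thetaFour t + thetaFour t * thetaThree t =
      2 * (thetaFour (2 * t) * thetaFour (2 * t)) by linarith
  simp only [thetaThree, thetaFour]
  rw [← h, ← (h2.mul_left 2).tsum_eq, tsum_even_lattice 0]
  · refine tsum_congr fun p ↦ ?_
    have e1 : (-1 : ℝ) ^ (p.1 + p.2 + 0) = (-1) ^ p.1 * (-1) ^ p.2 := by
      rw [add_zero, zpow_add₀ (by norm_num)]
    have e2 : (-1 : ℝ) ^ (p.1 - p.2) = (-1) ^ p.1 * (-1) ^ p.2 := by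
      rw [sub_eq_add_neg, zpow_add₀ (by norm_num), zpow_neg, ← inv_zpow]
      norm_num
    simp only [e1, e2]
    have e3 : exp (-π * t * ((p.1 + p.2 + 0 : ℤ) : ℝ) ^ 2) *
        exp (-π * t * ((p.1 - p.2 : ℤ) : ℝ) ^ 2) =
        exp (-π * (2 * t) * (p.1 : ℝ) ^ 2) * exp (-π * (2 * t) * (p.2 : ℝ) ^ 2) := by
      rw [← exp_add, ← exp_add]
      push_cast
      ring_nf
    linear_combination (2 * (-1) ^ p.1 * (-1) ^ p.2) * e3
  · intro p hp
    have h1 := neg_one_zpow_add_eq_neg_one (m := p.1) (n := p.2) (by omega)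
    have h3 : (-1 : ℝ) ^ p.1 + (-1) ^ p.2 = 0 := by
      rcases Int.even_or_odd p.1 with h | h
      · rw [h.neg_one_zpow] at h1 ⊢; linarith
      · rw [h.neg_one_zpow] at h1 ⊢; linarith
    linear_combination exp (-π * t * (p.1 : ℝ) ^ 2) * exp (-π * t * (p.2 : ℝ) ^ 2) * h3

/-- Jacobi's identity `θ₃⁴ = θ₂⁴ + θ₄⁴`. -/
lemma thetaThree_pow_four {t : ℝ} (ht : 0 < t) :
    thetaThree t ^ 4 = thetaTwo t ^ 4 + thetaFour t ^ 4 := by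
  have h := half_pos ht
  have h1 := thetaThree_sq_add_thetaFour_sq h
  have h2 := thetaThree_sq_sub_thetaFour_sq h
  have h3 := thetaThree_mul_thetaFour h
  rw [mul_div_cancel₀ t two_ne_zero] at h1 h2 h3
  have e1 : thetaThree t ^ 2 = (thetaThree (t / 2) ^ 2 + thetaFour (t / 2) ^ 2) / 2 := by linarith
  have e2 : thetaTwo t ^ 2 = (thetaThree (t / 2) ^ 2 - thetaFour (t / 2) ^ 2) / 2 := by linarith
  rw [show thetaThree t ^ 4 = (thetaThree t ^ 2) ^ 2 by ring,
    show thetaTwo t ^ 4 = (thetaTwo t ^ 2) ^ 2 by ring,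
    show thetaFour t ^ 4 = (thetaFour t ^ 2) ^ 2 by ring, e1, e2, ← h3]
  ring

lemma thetaThree_inv_sq {t : ℝ} (ht : 0 < t) : thetaThree t⁻¹ ^ 2 = t * thetaThree t ^ 2 := by
  have h := Real.tsum_exp_neg_mul_int_sq ht
  have e : thetaThree t = 1 / t ^ (1 / 2 : ℝ) * thetaThree t⁻¹ := by
    simpa only [thetaThree, div_eq_mul_inv] using h
  rw [e, mul_pow, div_pow, ← sqrt_eq_rpow, sq_sqrt ht.le]
  field_simp

lemma thetaTwo_inv_sq {t : ℝ} (ht : 0 < t) : thetaTwo t⁻¹ ^ 2 = t * thetaFour t ^ 2 := by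
  have h := Complex.tsum_exp_neg_quadratic (a := t) (by simpa using ht) (-Complex.I / 2)
  have e1 : ∀ n : ℤ, Complex.exp (-π * t * n ^ 2 + 2 * π * (-Complex.I / 2) * n) =
      (((-1 : ℝ) ^ n * exp (-π * t * (n : ℝ) ^ 2) : ℝ) : ℂ) := fun n ↦ by
    rw [Complex.exp_add, mul_comm]
    push_cast
    congr 1
    rw [show 2 * π * (-Complex.I / 2) * (n : ℂ) = n * (-(π * Complex.I)) by ring,
      Complex.exp_int_mul, Complex.exp_neg, Complex.exp_pi_mul_I]
    norm_num
  have e2 : ∀ n : ℤ, Complex.exp (-π / t * (n + Complex.I * (-Complex.I / 2)) ^ 2) =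
      ((exp (-π * t⁻¹ * ((n : ℝ) + 1 / 2) ^ 2) : ℝ) : ℂ) := fun n ↦ by
    push_cast
    rw [show Complex.I * (-Complex.I / 2) = 1 / 2 by
      linear_combination (-1 / 2) * Complex.I_mul_I, div_eq_mul_inv]
  simp only [e1, e2] at h
  rw [← Complex.ofReal_tsum, ← Complex.ofReal_tsum,
    show (1 / 2 : ℂ) = ((1 / 2 : ℝ) : ℂ) by push_cast; rfl, ← Complex.ofReal_cpow ht.le] at h
  have e : thetaFour t = 1 / t ^ (1 / 2 : ℝ) * thetaTwo t⁻¹ := by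
    simp only [thetaFour, thetaTwo]
    exact_mod_cast h
  rw [e, mul_pow, div_pow, ← sqrt_eq_rpow, sq_sqrt ht.le]
  field_simp

lemma tendsto_exp_theta_term (n : ℤ) :
    Tendsto (fun t : ℝ ↦ exp (-π * t * (n : ℝ) ^ 2)) atTop (𝓝 (if n = 0 then 1 else 0)) := by
  split_ifs with h
  · simp [h]
  · have h1 : 0 < π * (n : ℝ) ^ 2 := by positivity
    refine tendsto_exp_atBot.comp ?_
    have := tendsto_neg_atTop_atBot.comp (tendsto_id.const_mul_atTop h1)
    exact this.congr fun t ↦ by simp; ring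

lemma exp_theta_term_le {t : ℝ} (ht : 1 ≤ t) (n : ℤ) :
    exp (-π * t * (n : ℝ) ^ 2) ≤ exp (-π * 1 * (n : ℝ) ^ 2) := by
  rw [exp_le_exp]
  have : 0 ≤ π * (n : ℝ) ^ 2 := by positivity
  nlinarith

lemma tendsto_thetaThree : Tendsto thetaThree atTop (𝓝 1) := by
  rw [show (1 : ℝ) = ∑' n : ℤ, if n = 0 then 1 else 0 by simp]
  refine tendsto_tsum_of_dominated_convergence (summable_thetaThree one_pos)
    tendsto_exp_theta_term ?_
  filter_upwards [eventually_ge_atTop 1] with t ht n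
  rw [norm_of_nonneg (exp_pos _).le]
  exact exp_theta_term_le ht n

lemma tendsto_thetaFour : Tendsto thetaFour atTop (𝓝 1) := by
  rw [show (1 : ℝ) = ∑' n : ℤ, (-1 : ℝ) ^ n * if n = 0 then 1 else 0 by simp]
  refine tendsto_tsum_of_dominated_convergence (summable_thetaThree one_pos)
    (fun n ↦ (tendsto_exp_theta_term n).const_mul _) ?_
  filter_upwards [eventually_ge_atTop 1] with t ht n
  rw [norm_mul, norm_zpow, norm_neg, norm_one, one_zpow, one_mul, norm_of_nonneg (exp_pos _).le]
  exact exp_theta_term_le ht n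

lemma gaussIntegral_theta_two_mul {t : ℝ} (ht : 0 < t) :
    gaussIntegral (thetaThree (2 * t) ^ 2) (thetaFour (2 * t) ^ 2) =
      gaussIntegral (thetaThree t ^ 2) (thetaFour t ^ 2) := by
  have h3 := thetaThree_pos ht
  have h4 := thetaFour_pos ht
  rw [← gaussIntegral_agm (pow_pos h3 2) (pow_pos h4 2), thetaThree_sq_add_thetaFour_sq ht,
    ← mul_pow, sqrt_sq (by positivity), thetaThree_mul_thetaFour ht]
  congr 1
  ring

lemma gaussIntegral_theta {t : ℝ} (ht : 0 < t) :
    gaussIntegral (thetaThree t ^ 2) (thetaFour t ^ 2) = π / 2 := by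
  have hpos : ∀ n : ℕ, 0 < 2 ^ n * t := fun n ↦ by positivity
  have hconst : ∀ n : ℕ, gaussIntegral (thetaThree (2 ^ n * t) ^ 2) (thetaFour (2 ^ n * t) ^ 2) =
      gaussIntegral (thetaThree t ^ 2) (thetaFour t ^ 2) := fun n ↦ by
    induction n with
    | zero => simp
    | succ n ih => rw [pow_succ' (2 : ℝ) n, mul_assoc, gaussIntegral_theta_two_mul (hpos n), ih]
  have hT : Tendsto (fun n : ℕ ↦ 2 ^ n * t) atTop atTop :=
    (tendsto_pow_atTop_atTop_of_one_lt one_lt_two).atTop_mul_const ht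
  have h := tendsto_gaussIntegral (a := fun n ↦ thetaThree (2 ^ n * t) ^ 2)
    (b := fun n ↦ thetaFour (2 ^ n * t) ^ 2)
    (fun n ↦ pow_pos (thetaThree_pos (hpos n)) 2) (fun n ↦ pow_pos (thetaFour_pos (hpos n)) 2)
    (by simpa using (tendsto_thetaThree.comp hT).pow 2)
    (by simpa using (tendsto_thetaFour.comp hT).pow 2)
  simp only [hconst] at h
  exact tendsto_nhds_unique tendsto_const_nhds h

/-- The modulus `k = θ₂² / θ₃²` at the nome `e^{-πt}`. -/
noncomputable def thetaModulus (t : ℝ) : ℝ := thetaTwo t ^ 2 / thetaThree t ^ 2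

lemma thetaModulus_sq_add {t : ℝ} (ht : 0 < t) :
    thetaModulus t ^ 2 + (thetaFour t ^ 2 / thetaThree t ^ 2) ^ 2 = 1 := by
  have h3 := thetaThree_pos ht
  have h := thetaThree_pow_four ht
  rw [thetaModulus]
  field_simp
  linarith

lemma thetaModulus_pos {t : ℝ} (ht : 0 < t) : 0 < thetaModulus t :=
  div_pos (pow_pos (thetaTwo_pos ht) 2) (pow_pos (thetaThree_pos ht) 2)

lemma thetaModulus_lt_one {t : ℝ} (ht : 0 < t) : thetaModulus t < 1 := by
  have h := thetaModulus_sq_add ht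
  have h4 : 0 < thetaFour t ^ 2 / thetaThree t ^ 2 :=
    div_pos (pow_pos (thetaFour_pos ht) 2) (pow_pos (thetaThree_pos ht) 2)
  nlinarith

lemma ellK_thetaModulus {t : ℝ} (ht : 0 < t) :
    ellK (thetaModulus t) = thetaThree t ^ 2 * (π / 2) := by
  have h3 : 0 < thetaThree t ^ 2 := pow_pos (thetaThree_pos ht) 2
  rw [ellK_eq_gaussIntegral (thetaModulus_sq_add ht), ← gaussIntegral_theta ht]
  have h := gaussIntegral_smul h3 1 (thetaFour t ^ 2 / thetaThree t ^ 2)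
  rw [mul_one, mul_div_cancel₀ _ h3.ne'] at h
  rw [h, mul_inv_cancel_left₀ h3.ne']

lemma ellK_compl_thetaModulus {t : ℝ} (ht : 0 < t) :
    ellK √(1 - thetaModulus t ^ 2) = t * ellK (thetaModulus t) := by
  have h3 : 0 < thetaThree t ^ 2 := pow_pos (thetaThree_pos ht) 2
  have hk := thetaModulus_lt_one ht
  have hk0 := thetaModulus_pos ht
  have ht' := inv_pos.2 ht
  rw [ellK_thetaModulus ht, ellK_eq_gaussIntegral (y := thetaModulus t)
    (by rw [sq_sqrt (by nlinarith)]; ring)]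
  have h := gaussIntegral_smul h3 1 (thetaModulus t)
  rw [thetaModulus, mul_one, mul_div_cancel₀ _ h3.ne'] at h
  have e3 := thetaThree_inv_sq ht'
  have e2 := thetaTwo_inv_sq ht'
  rw [inv_inv] at e3 e2
  have h' := gaussIntegral_smul ht' (thetaThree t⁻¹ ^ 2) (thetaFour t⁻¹ ^ 2)
  rw [← e3, ← e2, inv_inv, gaussIntegral_theta ht', h] at h'
  rw [thetaModulus]
  rw [inv_mul_eq_iff_eq_mul₀ h3.ne'] at h'
  rw [h']
  ring

lemma qPoch_neg_pow_twelve {t q : ℝ} (ht : 0 < t) (hq : q = exp (-π * t)) :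
    exp (-π * t / 4) ^ 2 * (4 * (1 - thetaModulus t ^ 2) / thetaModulus t) =
      qPoch (-q) (q ^ 2) ^ 12 := by
  have hq0 : 0 < q := hq ▸ exp_pos _
  have hq1 : q < 1 := hq ▸ exp_neg_pi_mul_lt_one ht
  have hx0 : 0 ≤ q ^ 2 := by positivity
  have hx1 : q ^ 2 < 1 := by nlinarith
  have hE : 0 < qPoch (-q ^ 2) (q ^ 2) := qPoch_pos hx0 hx1 (by linarith)
  have hP : 0 < qPoch (-q) (q ^ 2) := qPoch_pos hx0 hx1 (by linarith)
  have hQ : 0 < qPoch q (q ^ 2) := qPoch_pos hx0 hx1 (by linarith)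
  have hR : 0 < qPoch (q ^ 2) (q ^ 2) := qPoch_pos hx0 hx1 (by linarith)
  have h1 := qPoch_mul_neg hx0 hx1 q
  have h2 := qPoch_even_mul_odd hx0 hx1 (-q ^ 2)
  have h3 := qPoch_mul_neg hx0 hx1 (q ^ 2)
  rw [show -(q ^ 2) ^ 2 = -q ^ 2 * q ^ 2 by ring] at h3
  rw [← h1, ← h3] at h2
  have hPQR : qPoch (-q) (q ^ 2) * qPoch q (q ^ 2) * qPoch (q ^ 2) (q ^ 2) = 1 := by
    refine mul_left_cancel₀ hE.ne' ?_
    linarith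
  rw [show 1 - thetaModulus t ^ 2 = (thetaFour t ^ 2 / thetaThree t ^ 2) ^ 2 by
    linarith [thetaModulus_sq_add ht], thetaModulus, thetaTwo_eq_prod ht hq,
    thetaThree_eq_prod ht hq, thetaFour_eq_prod ht hq]
  have hu := exp_pos (-π * t / 4)
  set u := exp (-π * t / 4)
  set E := qPoch (-q ^ 2) (q ^ 2)
  set P := qPoch (-q) (q ^ 2)
  set Q := qPoch q (q ^ 2)
  set R := qPoch (q ^ 2) (q ^ 2)
  have h4 : P ^ 4 * Q ^ 4 * R ^ 4 = 1 := by rw [← mul_pow, ← mul_pow, hPQR, one_pow]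
  field_simp
  linear_combination (-4 : ℝ) * h4

lemma etaP_eq_qPoch {q : ℝ} : etaP q = qPoch (-q) q := by
  rw [etaP, qPoch]
  refine tprod_congr fun n ↦ ?_
  rw [← Nat.cast_add_one, rpow_natCast]
  ring

lemma tsum_eq_etaP_mul_qPoch {q : ℝ} (hq0 : 0 < q) (hq1 : q < 1) :
    ∑' n : ℤ, (-1 : ℝ) ^ n * q ^ (2 * (n : ℝ) ^ 2 + (n : ℝ)) =
      etaP (q ^ 4) * qPoch (-q) (q ^ 2) := by
  have hx0 : 0 ≤ q ^ 2 := by positivity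
  have hx1 : q ^ 2 < 1 := by nlinarith
  have h := jacobi_triple_product (q := q ^ 2) (z := -q) (by positivity) hx1 (by linarith)
  rw [show (-q)⁻¹ * q ^ 2 = -q by field_simp, ← qPoch_even_mul_odd hx0 hx1 (-q),
    show (q ^ 2) ^ 2 = q ^ 4 by ring, ← etaP_eq_qPoch] at h
  rw [← h]
  refine tsum_congr fun n ↦ ?_
  rw [← neg_one_mul q, mul_zpow, rpow_add hq0, rpow_intCast, rpow_mul hq0.le]
  rw [show (n : ℝ) ^ 2 = ((n ^ 2 : ℤ) : ℝ) by push_cast; rfl, rpow_intCast, rpow_two]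
  ring

end ThetaFunctions

theorem stmt5 (r : ℝ) (hr : 0 < r) (q : ℝ) (hq : q = Real.exp (-π * Real.sqrt r))
    (k : ℝ) (hk0 : 0 < k) (hk1 : k < 1)
    (hk : ellK (Real.sqrt (1 - k ^ 2)) = Real.sqrt r * ellK k) :
    ∑' n : ℤ, (-1 : ℝ) ^ n * q ^ (2 * (n : ℝ) ^ 2 + (n : ℝ)) =
      q ^ ((1 : ℝ) / 24) * etaP (q ^ 4) * (4 * (1 - k ^ 2) / k) ^ ((1 : ℝ) / 12) := by
  have ht : 0 < √r := sqrt_pos.2 hr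
  have hq0 : 0 < q := hq ▸ exp_pos _
  have hq1 : q < 1 := hq ▸ exp_neg_pi_mul_lt_one ht
  have hkt : k = thetaModulus √r := singular_modulus_unique ht hk0 hk1 (thetaModulus_pos ht)
    (thetaModulus_lt_one ht) hk (ellK_compl_thetaModulus ht)
  have hP : 0 < qPoch (-q) (q ^ 2) := qPoch_pos (by positivity) (by nlinarith) (by linarith)
  have hm : 0 ≤ 4 * (1 - k ^ 2) / k := div_nonneg (by nlinarith) hk0.le
  have key := qPoch_neg_pow_twelve ht hq
  rw [← hkt] at key
  have hq24 : q ^ ((1 : ℝ) / 24) = (exp (-π * √r / 4) ^ 2) ^ ((1 : ℝ) / 12) := by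
    rw [← exp_nat_mul, hq, ← exp_mul, ← exp_mul]
    push_cast
    ring_nf
  rw [tsum_eq_etaP_mul_qPoch hq0 hq1, mul_right_comm, hq24, ← mul_rpow (by positivity) hm, key,
    mul_comm]
  congr 1
  have := pow_rpow_inv_natCast hP.le (n := 12) (by norm_num)
  rw [one_div]
  exact_mod_cast this.symm
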